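/- arXiv:2411.04463 — 2 statements merged into one kernel-verified Lean document; each statement's English description precedes it below -/
import Mathlib

section
/- Let G be a group with a left-invariant metric d whose balls B_m = {g ∈ G : d(g,1) ≤ m} are finite and satisfy |B_m| ≤ e^{Cm} for all m ∈ ℕ, for some C > 0. Let F, H : G × G → ℝ satisfy Gaussian bounds |F(g,h)| ≤ C₁ e^{−C₂ d(g,h)²} and |H(g,h)| ≤ C₁′ e^{−C₂′ d(g,h)²} for all g, h ∈ G, with constants C₁, C₂, C₁′, C₂′ > 0. Then for all g, h ∈ G the sum K(g,h) = ∑_{k∈G} F(g,k) H(k,h) converges absolutely, and there exist constants C₆, C₇ > 0 such that |K(g,h)| ≤ C₆ e^{−C₇ d(g,h)²} for all g, h ∈ G. -/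
/-!
Setting: `G` is a group equipped with a left-invariant metric `dist` whose closed balls
`B_m = {g : dist g 1 ≤ m}` are finite and satisfy the growth bound `|B_m| ≤ exp (C*m)`.
`F` and `H'` satisfy Gaussian bounds, and `K(g,h) = ∑_k F(g,k) H'(k,h)`.
-/

/-- If the balls around `x` have at most exponential growth, then a large enough negative
exponential of the (rounded) distance to `x` is summable. -/
theorem summable_exp_neg_ceil_dist {X : Type*} [PseudoMetricSpace X] (x : X)
    (hfin : ∀ m : ℕ, (Metric.closedBall x m).Finite) (C : ℝ)
    (hgrowth : ∀ m : ℕ, (Nat.card (Metric.closedBall x m) : ℝ) ≤ Real.exp (C * m)) :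
    Summable fun k : X => Real.exp (-(C + 1) * (⌈dist k x⌉₊ : ℝ)) := by
  let u : ℕ × X → ℝ := fun p =>
    (Metric.closedBall x (p.1 : ℝ)).indicator (fun _ => Real.exp (-(C + 1) * (p.1 : ℝ))) p.2
  have hu0 : 0 ≤ u := fun p => Set.indicator_nonneg (fun _ _ => (Real.exp_pos _).le) _
  have hu : Summable u := by
    rw [summable_prod_of_nonneg hu0]
    have hsum : ∀ n : ℕ, HasSum (fun y => u (n, y))
        (Nat.card (Metric.closedBall x (n : ℝ)) * Real.exp (-(C + 1) * (n : ℝ))) := by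
      intro n
      have h := hasSum_sum_of_ne_finset_zero (f := fun y => u (n, y))
        (L := .unconditional X) (s := (hfin n).toFinset)
        fun y hy => Set.indicator_of_notMem (by simpa using hy) _
      convert h using 1
      have hconst : ∀ y ∈ (hfin n).toFinset, u (n, y) = Real.exp (-(C + 1) * (n : ℝ)) :=
        fun y hy => Set.indicator_of_mem ((hfin n).mem_toFinset.1 hy) _
      rw [Finset.sum_congr rfl hconst, Finset.sum_const, nsmul_eq_mul,
        Nat.card_coe_set_eq, Set.ncard_eq_toFinset_card _ (hfin n)]
    refine ⟨fun n => (hsum n).summable, ?_⟩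
    refine Summable.of_nonneg_of_le (fun n => tsum_nonneg fun y => hu0 (n, y)) (fun n => ?_)
      Real.summable_exp_neg_nat
    rw [(hsum n).tsum_eq]
    calc _ ≤ Real.exp (C * n) * Real.exp (-(C + 1) * (n : ℝ)) := by gcongr; exact hgrowth n
      _ = Real.exp (-n) := by rw [← Real.exp_add]; ring_nf
  have hinj : Function.Injective fun k : X => (⌈dist k x⌉₊, k) :=
    fun _ _ h => (Prod.ext_iff.1 h).2
  refine (hu.comp_injective hinj).congr fun k => ?_
  have hk : k ∈ Metric.closedBall x (⌈dist k x⌉₊ : ℝ) := Metric.mem_closedBall.2 (Nat.le_ceil _)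
  simp only [Function.comp_apply, u, Set.indicator_of_mem hk]

/-- Gaussians are summable on a metric space with at most exponential growth. -/
theorem summable_exp_neg_mul_dist_sq {X : Type*} [PseudoMetricSpace X] (x : X)
    (hfin : ∀ m : ℕ, (Metric.closedBall x m).Finite) (C : ℝ) (hC : 0 < C)
    (hgrowth : ∀ m : ℕ, (Nat.card (Metric.closedBall x m) : ℝ) ≤ Real.exp (C * m))
    {a : ℝ} (ha : 0 < a) :
    Summable fun k : X => Real.exp (-a * dist k x ^ 2) := by
  refine Summable.of_nonneg_of_le (fun k => (Real.exp_pos _).le) (fun k => ?_)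
    ((summable_exp_neg_ceil_dist x hfin C hgrowth).mul_left
      (Real.exp ((C + 1) + (C + 1) ^ 2 / (4 * a))))
  rw [← Real.exp_add, Real.exp_le_exp]
  have hceil : (C + 1) * (⌈dist k x⌉₊ : ℝ) ≤ (C + 1) * (dist k x + 1) := by
    gcongr
    exact (Nat.ceil_lt_add_one dist_nonneg).le
  have hsq : (C + 1) * dist k x ≤ a * dist k x ^ 2 + (C + 1) ^ 2 / (4 * a) := by
    have h : a * dist k x ^ 2 + (C + 1) ^ 2 / (4 * a) - (C + 1) * dist k x
        = (2 * a * dist k x - (C + 1)) ^ 2 / (4 * a) := by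
      field_simp
      ring
    have h' : 0 ≤ (2 * a * dist k x - (C + 1)) ^ 2 / (4 * a) := by positivity
    linarith
  linarith

/-- A product of two Gaussians centred at `g` and `h` is bounded by a Gaussian in `dist g h` times
a Gaussian centred at `g`. -/
theorem exp_neg_dist_sq_mul_exp_neg_dist_sq_le {X : Type*} [PseudoMetricSpace X]
    {a b c : ℝ} (hc : 0 ≤ c) (ha : c ≤ a) (hb : c ≤ b) (g k h : X) :
    Real.exp (-a * dist g k ^ 2) * Real.exp (-b * dist k h ^ 2) ≤
      Real.exp (-(c / 4) * dist g h ^ 2) * Real.exp (-(c / 2) * dist g k ^ 2) := by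
  rw [← Real.exp_add, ← Real.exp_add, Real.exp_le_exp]
  have hsq : dist g h ^ 2 ≤ 2 * (dist g k ^ 2 + dist k h ^ 2) :=
    (pow_le_pow_left₀ dist_nonneg (dist_triangle g k h) 2).trans add_sq_le
  have h₁ := mul_le_mul_of_nonneg_left hsq hc
  have h₂ := mul_le_mul_of_nonneg_right ha (sq_nonneg (dist g k))
  have h₃ := mul_le_mul_of_nonneg_right hb (sq_nonneg (dist k h))
  have h₄ := mul_nonneg hc (sq_nonneg (dist k h))
  linarith

theorem stmt13 (G : Type*) [Group G] [MetricSpace G]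
    (hinv : ∀ k g h : G, dist (k * g) (k * h) = dist g h)
    (hballfin : ∀ m : ℕ, (Metric.closedBall (1 : G) m).Finite)
    (C : ℝ) (hC : 0 < C)
    (hgrowth : ∀ m : ℕ, (Nat.card (Metric.closedBall (1 : G) m) : ℝ) ≤ Real.exp (C * m))
    (F H' : G → G → ℝ) (C₁ C₂ C₁' C₂' : ℝ)
    (hC₁ : 0 < C₁) (hC₂ : 0 < C₂) (hC₁' : 0 < C₁') (hC₂' : 0 < C₂')
    (hF : ∀ g h : G, |F g h| ≤ C₁ * Real.exp (-C₂ * dist g h ^ 2))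
    (hH : ∀ g h : G, |H' g h| ≤ C₁' * Real.exp (-C₂' * dist g h ^ 2)) :
    (∀ g h : G, Summable fun k : G => |F g k * H' k h|) ∧
    ∃ C₆ > (0 : ℝ), ∃ C₇ > (0 : ℝ), ∀ g h : G,
      |∑' k : G, F g k * H' k h| ≤ C₆ * Real.exp (-C₇ * dist g h ^ 2) := by
  set c := min C₂ C₂'
  have hc : 0 < c := lt_min hC₂ hC₂'
  let E : G → ℝ := fun k => Real.exp (-(c / 2) * dist k 1 ^ 2)
  have hE : Summable E := summable_exp_neg_mul_dist_sq 1 hballfin C hC hgrowth (half_pos hc)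
  have htrans : ∀ g : G, HasSum (fun k => E (g⁻¹ * k)) (∑' k, E k) := fun g =>
    (Equiv.mulLeft g⁻¹).hasSum_iff.2 hE.hasSum
  have hEdist : ∀ g k : G, E (g⁻¹ * k) = Real.exp (-(c / 2) * dist g k ^ 2) := by
    intro g k
    simp only [E]
    rw [← hinv g (g⁻¹ * k) 1, mul_inv_cancel_left, mul_one, dist_comm]
  have hbound : ∀ g h k : G, |F g k * H' k h| ≤
      C₁ * C₁' * Real.exp (-(c / 4) * dist g h ^ 2) * E (g⁻¹ * k) := by
    intro g h k
    rw [abs_mul, hEdist]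
    calc |F g k| * |H' k h|
        ≤ (C₁ * Real.exp (-C₂ * dist g k ^ 2)) * (C₁' * Real.exp (-C₂' * dist k h ^ 2)) :=
          mul_le_mul (hF g k) (hH k h) (abs_nonneg _) (by positivity)
      _ = C₁ * C₁' * (Real.exp (-C₂ * dist g k ^ 2) * Real.exp (-C₂' * dist k h ^ 2)) := by ring
      _ ≤ C₁ * C₁' * (Real.exp (-(c / 4) * dist g h ^ 2) *
            Real.exp (-(c / 2) * dist g k ^ 2)) := by
          gcongr ?_ * ?_
          exact exp_neg_dist_sq_mul_exp_neg_dist_sq_le hc.le (min_le_left _ _) (min_le_right _ _)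
            g k h
      _ = _ := by ring
  refine ⟨fun g h => Summable.of_nonneg_of_le (fun k => abs_nonneg _) (hbound g h)
    ((htrans g).summable.mul_left _), C₁ * C₁' * ∑' k, E k, ?_, c / 4, by positivity,
    fun g h => ?_⟩
  · exact mul_pos (mul_pos hC₁ hC₁')
      (hE.tsum_pos (fun k => (Real.exp_pos _).le) 1 (Real.exp_pos _))
  · have h := tsum_of_norm_bounded (f := fun k => F g k * H' k h)
      ((htrans g).mul_left _) (hbound g h)
    rw [Real.norm_eq_abs] at h
    exact h.trans_eq (by ring)
end

section
/- Let G be a finitely generated infinite group and let φ ∈ ℓ∞(G) satisfy φ(g) = 0 for all but finitely many g ∈ G. Then φ belongs to 𝓘, the linear span of {ψ − g·ψ : g ∈ G, ψ ∈ ℓ∞(G)}. -/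
/-!
Setting: for a group `G`, the Banach space `ℓ∞(G)` of bounded real-valued functions on `G`
is realized as `lp (fun _ : G => ℝ) ∞`.  `G` acts on `ℓ∞(G)` by `(g·φ)(x) = φ(xg)`
(`rTranslate g φ`), `𝓘` (`Ispan G`) is the linear span of `{φ - g·φ}`, and `weakClosure`
is the closure in the weak topology of `ℓ∞(G)`.
-/

open scoped ENNReal

noncomputable section

/-- The action of `G` on `ℓ∞(G)`: `(g·φ)(x) = φ(xg)`. -/
def rTranslate {G : Type*} [Group G] (g : G) (φ : lp (fun _ : G => ℝ) ∞) :
    lp (fun _ : G => ℝ) ∞ :=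
  ⟨fun x => φ (x * g), by
    refine memℓp_infty ?_
    obtain ⟨M, hM⟩ := memℓp_infty_iff.mp (lp.memℓp φ)
    exact ⟨M, by rintro y ⟨x, rfl⟩; exact hM ⟨x * g, rfl⟩⟩⟩

/-- `𝓘`: the linear span of `{φ - g·φ : g ∈ G, φ ∈ ℓ∞(G)}` in `ℓ∞(G)`. -/
def Ispan (G : Type*) [Group G] : Submodule ℝ (lp (fun _ : G => ℝ) ∞) :=
  Submodule.span ℝ {ψ | ∃ (g : G) (φ : lp (fun _ : G => ℝ) ∞), ψ = φ - rTranslate g φ}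

/-- The closure of a subset of `ℓ∞(G)` in the weak topology (the topology induced by the
continuous dual of `ℓ∞(G)`). -/
def weakClosure (G : Type*) (S : Set (lp (fun _ : G => ℝ) ∞)) :
    Set (lp (fun _ : G => ℝ) ∞) :=
  closure (X := WeakSpace ℝ (lp (fun _ : G => ℝ) ∞)) S

/-- A `G`-invariant mean on `ℓ∞(G)`: a positive linear map `μ : ℓ∞(G) → ℝ` with `μ(𝟙) = 1`
and `μ(g·φ) = μ(φ)` for all `g` and `φ`. -/
structure IsInvariantMean (G : Type*) [Group G] (μ : lp (fun _ : G => ℝ) ∞ → ℝ) : Prop where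
  map_add : ∀ φ ψ, μ (φ + ψ) = μ φ + μ ψ
  map_smul : ∀ (c : ℝ) (φ), μ (c • φ) = c * μ φ
  pos : ∀ φ, (∀ x, 0 ≤ φ x) → 0 ≤ μ φ
  map_one : μ 1 = 1
  invariant : ∀ (g : G) (φ), μ (rTranslate g φ) = μ φ

open scoped Pointwise in
/-- The word length of `x` with respect to `S` (junk value `0` if `x` is not a product of
elements of `S`). -/
def wordLength {G : Type*} [Group G] (S : Set G) (x : G) : ℕ :=
  sInf {n | x ∈ S ^ n}

section WordLength

open scoped Pointwise

variable {G : Type*} [Group G] {S : Set G}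

theorem exists_mem_pow_of_closure_eq_top (hS : Submonoid.closure S = ⊤) (x : G) :
    ∃ n : ℕ, x ∈ S ^ n := by
  have hx : x ∈ Submonoid.closure S := hS ▸ Submonoid.mem_top x
  induction hx using Submonoid.closure_induction with
  | mem y hy => exact ⟨1, by simpa using hy⟩
  | one => exact ⟨0, by simp⟩
  | mul y z _ _ hy hz =>
    obtain ⟨m, hm⟩ := hy
    obtain ⟨n, hn⟩ := hz
    exact ⟨m + n, pow_add S m n ▸ Set.mul_mem_mul hm hn⟩

theorem mem_pow_wordLength (hS : Submonoid.closure S = ⊤) (x : G) : x ∈ S ^ wordLength S x :=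
  Nat.sInf_mem (exists_mem_pow_of_closure_eq_top hS x)

theorem wordLength_le_of_mem_pow {x : G} {n : ℕ} (hx : x ∈ S ^ n) : wordLength S x ≤ n :=
  Nat.sInf_le hx

theorem wordLength_one : wordLength S (1 : G) = 0 :=
  Nat.le_zero.mp (wordLength_le_of_mem_pow (by simp))

theorem wordLength_mul_le (hS : Submonoid.closure S = ⊤) (x y : G) :
    wordLength S (x * y) ≤ wordLength S x + wordLength S y :=
  wordLength_le_of_mem_pow
    (pow_add S _ _ ▸ Set.mul_mem_mul (mem_pow_wordLength hS x) (mem_pow_wordLength hS y))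

/-- The elements `y` for which some geodesic from `1` to `y` passes through `x`. -/
def geodesicCone (S : Set G) (x : G) : Set G :=
  {y | wordLength S y = wordLength S x + wordLength S (x⁻¹ * y)}

theorem exists_mem_geodesicCone_mul (hS : Submonoid.closure S = ⊤) {x y : G}
    (hy : y ∈ geodesicCone S x) (hyx : y ≠ x) :
    ∃ s ∈ S, wordLength S (x * s) = wordLength S x + 1 ∧ y ∈ geodesicCone S (x * s) := by
  have hmem := mem_pow_wordLength hS (x⁻¹ * y)
  have hy' : wordLength S y = wordLength S x + wordLength S (x⁻¹ * y) := hy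
  rcases hn : wordLength S (x⁻¹ * y) with _ | n
  · rw [hn, pow_zero, Set.mem_one, inv_mul_eq_one] at hmem
    exact absurd hmem.symm hyx
  · rw [hn, pow_succ', Set.mem_mul] at hmem
    obtain ⟨s, hs, w, hw, hsw⟩ := hmem
    have hw_eq : (x * s)⁻¹ * y = w := by
      rw [mul_inv_rev, mul_assoc, ← hsw, inv_mul_cancel_left]
    have hw_le := wordLength_le_of_mem_pow hw
    have hs_le : wordLength S s ≤ 1 := wordLength_le_of_mem_pow (by simpa using hs)
    have hxs_le := wordLength_mul_le hS x s
    have hy_le := wordLength_mul_le hS (x * s) w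
    rw [← hw_eq, mul_inv_cancel_left, hw_eq] at hy_le
    refine ⟨s, hs, by lia, ?_⟩
    change wordLength S y = wordLength S (x * s) + wordLength S ((x * s)⁻¹ * y)
    rw [hw_eq]
    lia

theorem exists_infinite_geodesicCone_mul (hfin : S.Finite) (hS : Submonoid.closure S = ⊤) {x : G}
    (hx : (geodesicCone S x).Infinite) :
    ∃ s ∈ S, wordLength S (x * s) = wordLength S x + 1 ∧ (geodesicCone S (x * s)).Infinite := by
  by_contra! h
  refine hx (Set.Finite.subset (((hfin.subset (Set.sep_subset S
    fun s => wordLength S (x * s) = wordLength S x + 1)).biUnion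
      (t := fun s => geodesicCone S (x * s)) ?_).insert x) ?_)
  · rintro s ⟨hs, hlen⟩
    exact h s hs hlen
  · intro y hy
    by_cases hyx : y = x
    · exact Or.inl hyx
    · obtain ⟨s, hs, hlen, hmem⟩ := exists_mem_geodesicCone_mul hS hy hyx
      exact Or.inr (Set.mem_biUnion (show s ∈ {s ∈ S | _} from ⟨hs, hlen⟩) hmem)

/-- An infinite group generated as a monoid by a finite set `S` contains an injective ray in its
Cayley graph. -/
theorem exists_injective_ray [Infinite G] (hfin : S.Finite) (hS : Submonoid.closure S = ⊤) :
    ∃ r : ℕ → G, r 0 = 1 ∧ Function.Injective r ∧ ∀ n, ∃ s ∈ S, r (n + 1) = r n * s := by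
  choose! step hstep hlen hinf using
    fun x (hx : (geodesicCone S x).Infinite) => exists_infinite_geodesicCone_mul hfin hS hx
  let r : ℕ → G := fun n => Nat.rec 1 (fun _ x => x * step x) n
  have hr : ∀ n, (geodesicCone S (r n)).Infinite ∧ wordLength S (r n) = n := by
    intro n
    induction n with
    | zero =>
      refine ⟨?_, wordLength_one⟩
      have huniv : geodesicCone S (1 : G) = Set.univ := by
        ext y
        simp [geodesicCone, wordLength_one]
      change (geodesicCone S (1 : G)).Infinite
      exact huniv ▸ Set.infinite_univ
    | succ n ih => exact ⟨hinf _ ih.1, (hlen _ ih.1).trans (by rw [ih.2])⟩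
  exact ⟨r, rfl, Function.LeftInverse.injective fun n => (hr n).2,
    fun n => ⟨step (r n), hstep _ (hr n).1, rfl⟩⟩

end WordLength

section Indicator

variable {G : Type*}

open scoped Classical in
/-- The indicator function of a set, as an element of `ℓ∞(G)`. -/
def linftyIndicator (A : Set G) : lp (fun _ : G => ℝ) ∞ :=
  ⟨fun x => if x ∈ A then 1 else 0, memℓp_infty ⟨1, by
    rintro _ ⟨x, rfl⟩
    dsimp only
    split_ifs <;> simp⟩⟩

open scoped Classical in
theorem linftyIndicator_apply (A : Set G) (x : G) :
    linftyIndicator A x = if x ∈ A then 1 else 0 := rfl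

theorem eq_sum_smul_linftyIndicator_singleton (φ : lp (fun _ : G => ℝ) ∞)
    (hφ : {x : G | φ x ≠ 0}.Finite) :
    φ = ∑ g ∈ hφ.toFinset, φ g • linftyIndicator {g} := by
  ext x
  rw [lp.coeFn_sum, Finset.sum_apply]
  simp only [lp.coeFn_smul, Pi.smul_apply, linftyIndicator_apply, smul_eq_mul]
  rw [Finset.sum_eq_single x]
  · simp
  · intro g _ hg
    simp [hg.symm]
  · intro hx
    simpa using hx

variable [Group G]

theorem rTranslate_apply (g : G) (φ : lp (fun _ : G => ℝ) ∞) (x : G) :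
    rTranslate g φ x = φ (x * g) := rfl

theorem sub_rTranslate_mem_Ispan (g : G) (φ : lp (fun _ : G => ℝ) ∞) :
    φ - rTranslate g φ ∈ Ispan G :=
  Submodule.subset_span ⟨g, φ, rfl⟩

/-- The starting point of an injective ray with steps in a finite set has its indicator function
in `𝓘`: sum the coboundaries of the indicators of the points of the ray left by a given step. -/
theorem linftyIndicator_ray_zero_mem_Ispan (S : Finset G) {r : ℕ → G}
    (hinj : Function.Injective r) (hstep : ∀ n, ∃ s ∈ S, r (n + 1) = r n * s) :
    linftyIndicator {r 0} ∈ Ispan G := by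
  classical
  choose s hs hrs using hstep
  let A : G → Set G := fun t => {x | ∃ n, x = r n ∧ s n = t}
  have hA : ∀ t n, r n ∈ A t ↔ s n = t := fun t n =>
    ⟨fun ⟨m, hm, ht⟩ => hinj hm ▸ ht, fun ht => ⟨n, rfl, ht⟩⟩
  have hA_shift : ∀ t x, x * t⁻¹ ∈ A t ↔ ∃ n, x = r (n + 1) ∧ s n = t := by
    refine fun t x => exists_congr fun n => and_congr_left ?_
    rintro rfl
    rw [hrs, mul_inv_eq_iff_eq_mul]
  have hA_shift_succ : ∀ t n, r (n + 1) * t⁻¹ ∈ A t ↔ s n = t := fun t n => by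
    rw [hA_shift]
    exact ⟨fun ⟨m, hm, ht⟩ => Nat.succ_injective (hinj hm) ▸ ht, fun ht => ⟨n, rfl, ht⟩⟩
  have hsum : linftyIndicator {r 0} =
      ∑ t ∈ S, (linftyIndicator (A t) - rTranslate t⁻¹ (linftyIndicator (A t))) := by
    ext x
    rw [lp.coeFn_sum, Finset.sum_apply]
    simp only [lp.coeFn_sub, Pi.sub_apply, rTranslate_apply, linftyIndicator_apply,
      Set.mem_singleton_iff, Finset.sum_sub_distrib]
    by_cases hx : ∃ n, r n = x
    · obtain ⟨n, rfl⟩ := hx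
      simp only [hA, hinj.eq_iff, Finset.sum_ite_eq, hs, if_true]
      rcases n with _ | n
      · have hzero : ∀ t, r 0 * t⁻¹ ∉ A t := fun t ht => by
          obtain ⟨n, hn, -⟩ := (hA_shift t _).mp ht
          exact absurd (hinj hn) (Nat.succ_ne_zero n).symm
        simp [hzero]
      · simp [hA_shift_succ, hs]
    · have hx_zero : x ≠ r 0 := fun h => hx ⟨0, h.symm⟩
      have hx_mem : ∀ t, x ∉ A t := fun t ⟨n, hn, _⟩ => hx ⟨n, hn.symm⟩
      have hx_shift : ∀ t, x * t⁻¹ ∉ A t := fun t ht => by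
        obtain ⟨n, hn, -⟩ := (hA_shift t x).mp ht
        exact hx ⟨n + 1, hn.symm⟩
      simp [hx_zero, hx_mem, hx_shift]
  rw [hsum]
  exact Submodule.sum_mem _ fun t _ => sub_rTranslate_mem_Ispan _ _

theorem linftyIndicator_singleton_mem_Ispan [Infinite G] (hfg : Group.FG G) (g : G) :
    linftyIndicator {g} ∈ Ispan G := by
  obtain ⟨S, hS⟩ := (Group.fg_iff_monoid_fg.mp hfg).fg_top
  obtain ⟨r, hr_zero, hinj, hstep⟩ := exists_injective_ray S.finite_toSet hS
  have hmem := linftyIndicator_ray_zero_mem_Ispan S (r := fun n => g * r n)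
    ((mul_right_injective g).comp hinj) fun n => by
      obtain ⟨s, hs, h⟩ := hstep n
      exact ⟨s, hs, by rw [h, mul_assoc]⟩
  simpa only [hr_zero, mul_one] using hmem

end Indicator

theorem stmt16 (G : Type*) [Group G] [Infinite G] (hfg : Group.FG G)
    (φ : lp (fun _ : G => ℝ) ∞) (hφ : {x : G | φ x ≠ 0}.Finite) :
    φ ∈ Ispan G := by
  rw [eq_sum_smul_linftyIndicator_singleton φ hφ]
  exact Submodule.sum_mem _ fun g _ =>
    Submodule.smul_mem _ _ (linftyIndicator_singleton_mem_Ispan hfg g)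
end
end
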